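/- Assume the comparison principle (CP) holds for the level-set horizontal curvature flow. Let C ∈ ℝ and K₀ ⊂ ℍ be compact. Let u₀ ∈ C(ℍ) be h-quasiconvex in ℍ with u₀ = C on ℍ∖K₀. Assume there is a sequence û_{0,j} ∈ C(ℍ) of functions uniformly h-quasiconvex in ℍ, each satisfying û_{0,j}(p) ≤ L_j(|p|_G⁴ + 1) for all p ∈ ℍ and some L_j > 0, such that u_{0,j} := min{û_{0,j}, C} satisfies u_{0,j} = C outside K₀ for every j and u_{0,j} → u₀ uniformly on ℍ as j → ∞. Let u ∈ C(ℍ×[0,∞)) be the unique viscosity solution of the level-set horizontal curvature flow with u(·,0) = u₀, satisfying u ≤ C and u = C outside K₀×[0,∞). Then u(·,t) is h-quasiconvex in ℍ for every t ≥ 0. -/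

import Mathlib

open Filter Topology

noncomputable section

abbrev Heis := ℝ × ℝ × ℝ

def hMul (p q : Heis) : Heis :=
  (p.1 + q.1, p.2.1 + q.2.1, p.2.2 + q.2.2 + (p.1 * q.2.1 - q.1 * p.2.1) / 2)

def horiz : Set Heis := {h : Heis | h.2.2 = 0}

def hPlane (p : Heis) : Set Heis := {q : Heis | ∃ h ∈ horiz, q = hMul p h}

def hSeg (p q : Heis) : Set Heis :=
  {w : Heis | ∃ l : ℝ, 0 ≤ l ∧ l ≤ 1 ∧ w = l • p + (1 - l) • q}

def HConvex (E : Set Heis) : Prop :=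
  ∀ p ∈ E, ∀ q ∈ E, q ∈ hPlane p → hSeg p q ⊆ E

def HQuasiconvexOn (f : Heis → ℝ) (Ω : Set Heis) : Prop :=
  ∀ p ∈ Ω, ∀ q ∈ Ω, q ∈ hPlane p → ∀ w ∈ hSeg p q, f w ≤ max (f p) (f q)

def X1 (f : Heis → ℝ) (p : Heis) : ℝ :=
  fderiv ℝ f p (1, 0, 0) - p.2.1 / 2 * fderiv ℝ f p (0, 0, 1)

def X2 (f : Heis → ℝ) (p : Heis) : ℝ :=
  fderiv ℝ f p (0, 1, 0) + p.1 / 2 * fderiv ℝ f p (0, 0, 1)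

def gradH (f : Heis → ℝ) (p : Heis) : ℝ × ℝ := (X1 f p, X2 f p)

def hessH (f : Heis → ℝ) (p : Heis) : ℝ × ℝ × ℝ :=
  (X1 (X1 f) p, (X1 (X2 f) p + X2 (X1 f) p) / 2, X2 (X2 f) p)

def L0H (ξ : ℝ × ℝ) (A : ℝ × ℝ × ℝ) : ℝ :=
  sInf {m : ℝ | ∃ η : ℝ × ℝ, η.1 ^ 2 + η.2 ^ 2 = 1 ∧ ξ.1 * η.1 + ξ.2 * η.2 = 0 ∧
    m = A.1 * η.1 ^ 2 + 2 * A.2.1 * η.1 * η.2 + A.2.2 * η.2 ^ 2}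

def Lop (f : Heis → ℝ) (p : Heis) : ℝ := L0H (gradH f p) (hessH f p)

def LbarOp (f : Heis → ℝ) (p : Heis) : ℝ := limsup (Lop f) (𝓝 p)

def LstarOp (f : Heis → ℝ) (p : Heis) : ℝ :=
  limsup (fun q : (ℝ × ℝ) × ℝ × ℝ × ℝ => L0H q.1 q.2) (𝓝 (gradH f p, hessH f p))

def StrictLocalMaxOnSet (g : Heis → ℝ) (Ω : Set Heis) (p : Heis) : Prop :=
  ∃ U ∈ 𝓝 p, ∀ q ∈ U ∩ Ω, q ≠ p → g q < g p

def UniformlyHQuasiconvexOn (f : Heis → ℝ) (Ω : Set Heis) (r₀ lam : ℝ) : Prop :=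
  ∀ r : ℝ, 0 < r → r < r₀ → ∀ p ∈ Ω, ∀ v ∈ horiz, v.1 ^ 2 + v.2.1 ^ 2 = 1 →
    hMul p (r • v) ∈ Ω → hMul p (-(r • v)) ∈ Ω →
    f p ≤ max (f (hMul p (r • v))) (f (hMul p (-(r • v)))) - lam * r ^ 2

def gaugeK (p : Heis) : ℝ := ((p.1 ^ 2 + p.2.1 ^ 2) ^ 2 + 16 * p.2.2 ^ 2) ^ ((1 : ℝ) / 4)


/-- The horizontal curvature operator `F(ξ, A) = -tr((I - ξ⊗ξ/|ξ|²) A)`,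
where `A = (a, b, c)` encodes the symmetric matrix `[[a,b],[b,c]]`. -/
def Fcurv (ξ : ℝ × ℝ) (A : ℝ × ℝ × ℝ) : ℝ :=
  -(A.1 + A.2.2) +
    (A.1 * ξ.1 ^ 2 + 2 * A.2.1 * ξ.1 * ξ.2 + A.2.2 * ξ.2 ^ 2) / (ξ.1 ^ 2 + ξ.2 ^ 2)

/-- Upper semicontinuous envelope `F*` of `Fcurv` (relative to `ξ ≠ 0`). -/
def FcurvUpper (ξ : ℝ × ℝ) (A : ℝ × ℝ × ℝ) : ℝ :=
  limsup (fun q : (ℝ × ℝ) × ℝ × ℝ × ℝ => Fcurv q.1 q.2)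
    (𝓝[{q : (ℝ × ℝ) × ℝ × ℝ × ℝ | q.1 ≠ 0}] (ξ, A))

/-- Lower semicontinuous envelope `F_*` of `Fcurv` (relative to `ξ ≠ 0`). -/
def FcurvLower (ξ : ℝ × ℝ) (A : ℝ × ℝ × ℝ) : ℝ :=
  liminf (fun q : (ℝ × ℝ) × ℝ × ℝ × ℝ => Fcurv q.1 q.2)
    (𝓝[{q : (ℝ × ℝ) × ℝ × ℝ × ℝ | q.1 ≠ 0}] (ξ, A))

/-- Viscosity subsolution of the level-set horizontal curvature flow
`u_t + F_*(∇_H u, (∇²_H u)*) ≤ 0` in `ℍ × (0, ∞)`. -/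
def FlowSubsolution (u : Heis × ℝ → ℝ) : Prop :=
  ∀ φ : Heis × ℝ → ℝ, ContDiff ℝ (⊤ : ℕ∞) φ → ∀ p : Heis, ∀ t : ℝ, 0 < t →
    (∃ U ∈ 𝓝 ((p, t) : Heis × ℝ), ∀ q ∈ U, 0 < q.2 → q ≠ (p, t) →
      u q - φ q < u (p, t) - φ (p, t)) →
    deriv (fun s => φ (p, s)) t +
      FcurvLower (gradH (fun w => φ (w, t)) p) (hessH (fun w => φ (w, t)) p) ≤ 0

/-- Viscosity supersolution of the level-set horizontal curvature flow. -/
def FlowSupersolution (u : Heis × ℝ → ℝ) : Prop :=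
  ∀ φ : Heis × ℝ → ℝ, ContDiff ℝ (⊤ : ℕ∞) φ → ∀ p : Heis, ∀ t : ℝ, 0 < t →
    (∃ U ∈ 𝓝 ((p, t) : Heis × ℝ), ∀ q ∈ U, 0 < q.2 → q ≠ (p, t) →
      u (p, t) - φ (p, t) < u q - φ q) →
    0 ≤ deriv (fun s => φ (p, s)) t +
      FcurvUpper (gradH (fun w => φ (w, t)) p) (hessH (fun w => φ (w, t)) p)

/-- The comparison principle (CP) for the level-set horizontal curvature flow. -/
def CPholds : Prop :=
  ∀ (C : ℝ) (K : Set Heis), IsCompact K →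
    ∀ u v : Heis × ℝ → ℝ,
      UpperSemicontinuousOn u {q : Heis × ℝ | 0 ≤ q.2} →
      LowerSemicontinuousOn v {q : Heis × ℝ | 0 ≤ q.2} →
      FlowSubsolution u → FlowSupersolution v →
      (∀ q : Heis × ℝ, 0 ≤ q.2 → u q ≤ C ∧ v q ≤ C) →
      (∀ q : Heis × ℝ, 0 ≤ q.2 → q.1 ∉ K → u q = C ∧ v q = C) →
      (∀ p : Heis, u (p, 0) ≤ v (p, 0)) →
      ∀ q : Heis × ℝ, 0 ≤ q.2 → u q ≤ v q

/-! ### Horizontal translations and the discrete game operator -/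

/-- The point `p · (s(a,b,0))`. -/
def hMove (p : Heis) (s a b : ℝ) : Heis :=
  (p.1 + s * a, p.2.1 + s * b, p.2.2 + s * (p.1 * b - a * p.2.1) / 2)

lemma hMul_smul_horiz (p : Heis) (s a b : ℝ) :
    hMul p (s • ((a, b, 0) : Heis)) = hMove p s a b := by
  ext <;> simp [hMul, hMove]
  ring

lemma hMul_neg_smul_horiz (p : Heis) (s a b : ℝ) :
    hMul p (-(s • ((a, b, 0) : Heis))) = hMove p (-s) a b := by
  rw [← neg_smul, hMul_smul_horiz]

lemma hMove_hMove (p : Heis) (s s' a b : ℝ) :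
    hMove (hMove p s a b) s' a b = hMove p (s + s') a b := by
  ext <;> simp [hMove] <;> ring

lemma hMove_zero (p : Heis) (a b : ℝ) : hMove p 0 a b = p := by
  ext <;> simp [hMove]

lemma hMove_neg_neg (p : Heis) (s a b : ℝ) : hMove p s (-a) (-b) = hMove p (-s) a b := by
  ext <;> simp [hMove]
  ring

lemma continuous_hMove : Continuous fun x : Heis × ℝ × ℝ × ℝ => hMove x.1 x.2.1 x.2.2.1 x.2.2.2 := by
  unfold hMove
  fun_prop

/-- The unit circle of horizontal directions. -/
abbrev UnitDir := {v : ℝ × ℝ // v.1 ^ 2 + v.2 ^ 2 = 1}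

instance : Nonempty UnitDir := ⟨⟨(1, 0), by norm_num⟩⟩

/-- One step of the two-player game: the first player chooses a direction to minimize, the second
player a sign to maximize. -/
def gameStep (e : ℝ) (f : Heis → ℝ) (p : Heis) : ℝ :=
  ⨅ v : UnitDir, max (f (hMove p e v.1.1 v.1.2)) (f (hMove p (-e) v.1.1 v.1.2))

lemma le_gameStep {e c : ℝ} {f : Heis → ℝ} {p : Heis}
    (h : ∀ a b : ℝ, a ^ 2 + b ^ 2 = 1 → c ≤ max (f (hMove p e a b)) (f (hMove p (-e) a b))) :
    c ≤ gameStep e f p :=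
  le_ciInf fun v => h _ _ v.2

lemma gameStep_le {e m : ℝ} {f : Heis → ℝ} (hm : ∀ q, m ≤ f q) (p : Heis) {a b : ℝ}
    (hab : a ^ 2 + b ^ 2 = 1) :
    gameStep e f p ≤ max (f (hMove p e a b)) (f (hMove p (-e) a b)) :=
  ciInf_le (f := fun v : UnitDir =>
    max (f (hMove p e v.1.1 v.1.2)) (f (hMove p (-e) v.1.1 v.1.2)))
    ⟨m, by rintro _ ⟨v, rfl⟩; exact (hm _).trans (le_max_left _ _)⟩ ⟨(a, b), hab⟩

lemma exists_of_gameStep_lt {e c : ℝ} {f : Heis → ℝ} {p : Heis} (h : gameStep e f p < c) :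
    ∃ a b : ℝ, a ^ 2 + b ^ 2 = 1 ∧ f (hMove p e a b) < c ∧ f (hMove p (-e) a b) < c := by
  obtain ⟨v, hv⟩ := exists_lt_of_ciInf_lt h
  exact ⟨_, _, v.2, max_lt_iff.1 hv⟩

lemma gameStep_le_add {e m c : ℝ} {f g : Heis → ℝ} (hm : ∀ q, m ≤ f q)
    (hfg : ∀ q, f q ≤ g q + c) (p : Heis) : gameStep e f p ≤ gameStep e g p + c := by
  rw [← sub_le_iff_le_add]
  refine le_gameStep fun a b hab => ?_
  rw [sub_le_iff_le_add, ← max_add_add_right]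
  exact (gameStep_le hm p hab).trans (max_le_max (hfg _) (hfg _))

lemma gameStep_min {e m C : ℝ} {f : Heis → ℝ} (hm : ∀ q, m ≤ f q) (p : Heis) :
    gameStep e (fun q => min (f q) C) p = min (gameStep e f p) C := by
  have hm' : ∀ q, min m C ≤ min (f q) C := fun q => min_le_min_right _ (hm q)
  apply le_antisymm
  · refine le_min (le_gameStep fun a b hab => ?_) ?_
    · exact (gameStep_le hm' p hab).trans (max_le_max (min_le_left _ _) (min_le_left _ _))
    · exact (gameStep_le (a := 1) (b := 0) hm' p (by norm_num)).trans
        (max_le (min_le_right _ _) (min_le_right _ _))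
  · refine le_gameStep fun a b hab => ?_
    rw [← min_max_distrib_right]
    exact min_le_min_right _ (gameStep_le hm p hab)

lemma le_gameStep_iterate {e m : ℝ} {f : Heis → ℝ} (hm : ∀ q, m ≤ f q) (n : ℕ) (p : Heis) :
    m ≤ (gameStep e)^[n] f p := by
  induction n generalizing p with
  | zero => exact hm p
  | succ n ih =>
    rw [Function.iterate_succ_apply']
    exact le_gameStep fun a b _ => (ih _).trans (le_max_left _ _)

lemma gameStep_iterate_le {e m C : ℝ} {f : Heis → ℝ} (hm : ∀ q, m ≤ f q) (hC : ∀ q, f q ≤ C)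
    (n : ℕ) (p : Heis) : (gameStep e)^[n] f p ≤ C := by
  induction n generalizing p with
  | zero => exact hC p
  | succ n ih =>
    rw [Function.iterate_succ_apply']
    exact (gameStep_le (a := 1) (b := 0) (le_gameStep_iterate hm n) p (by norm_num)).trans
      (max_le (ih _) (ih _))

lemma gameStep_iterate_le_add {e m c : ℝ} {f g : Heis → ℝ} (hm : ∀ q, m ≤ f q)
    (hfg : ∀ q, f q ≤ g q + c) (n : ℕ) (p : Heis) :
    (gameStep e)^[n] f p ≤ (gameStep e)^[n] g p + c := by
  induction n generalizing p with
  | zero => exact hfg p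
  | succ n ih =>
    rw [Function.iterate_succ_apply', Function.iterate_succ_apply']
    exact gameStep_le_add (le_gameStep_iterate hm n) ih p

lemma gameStep_iterate_min {e m C : ℝ} {f : Heis → ℝ} (hm : ∀ q, m ≤ f q) (n : ℕ) (p : Heis) :
    (gameStep e)^[n] (fun q => min (f q) C) p = min ((gameStep e)^[n] f p) C := by
  induction n generalizing p with
  | zero => rfl
  | succ n ih =>
    rw [Function.iterate_succ_apply', Function.iterate_succ_apply', funext ih,
      gameStep_min (le_gameStep_iterate hm n)]

lemma gameStep_iterate_add_le_succ {e m c : ℝ} {f : Heis → ℝ} (hm : ∀ q, m ≤ f q)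
    (hf : ∀ q, f q + c ≤ gameStep e f q) (n : ℕ) (p : Heis) :
    (gameStep e)^[n] f p + c ≤ (gameStep e)^[n + 1] f p := by
  rw [← le_sub_iff_add_le, sub_eq_add_neg, Function.iterate_succ_apply]
  exact gameStep_iterate_le_add hm (fun q => by linarith [hf q]) n p

lemma le_max_of_forall_lt_max_neighbors {a : ℤ → ℝ} (ha : ∀ i, a i < max (a (i - 1)) (a (i + 1)))
    {l m : ℤ} (hl : l ≤ 0) (hm : 0 ≤ m) : a 0 ≤ max (a l) (a m) := by
  obtain ⟨i, hi, hmax⟩ := (Finset.Icc l m).exists_max_image a ⟨0, by simp [hl, hm]⟩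
  have h0 := hmax 0 (by simp [hl, hm])
  rw [Finset.mem_Icc] at hi
  rcases eq_or_lt_of_le hi.1 with rfl | h1
  · exact h0.trans (le_max_left _ _)
  rcases eq_or_lt_of_le hi.2 with rfl | h2
  · exact h0.trans (le_max_right _ _)
  have h3 := hmax (i - 1) (by rw [Finset.mem_Icc]; omega)
  have h4 := hmax (i + 1) (by rw [Finset.mem_Icc]; omega)
  exact absurd (ha i) (not_lt.2 (max_le h3 h4))

/-- Strict monotonicity of the game values in time forces discrete quasiconvexity along horizontal
lines. -/
lemma gameStep_iterate_quasiconvex {e m c : ℝ} {f : Heis → ℝ} (hc : 0 < c) (hm : ∀ q, m ≤ f q)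
    (hf : ∀ q, f q + c ≤ gameStep e f q) (n : ℕ) (p : Heis) {a b : ℝ} (hab : a ^ 2 + b ^ 2 = 1)
    (i j : ℕ) :
    (gameStep e)^[n] f p ≤ max ((gameStep e)^[n] f (hMove p (-(i * e)) a b))
      ((gameStep e)^[n] f (hMove p (j * e) a b)) := by
  have key : ∀ l : ℤ, (gameStep e)^[n] f (hMove p (l * e) a b) <
      max ((gameStep e)^[n] f (hMove p ((l - 1 : ℤ) * e) a b))
        ((gameStep e)^[n] f (hMove p ((l + 1 : ℤ) * e) a b)) := by
    intro l
    have h1 := gameStep_iterate_add_le_succ hm hf n (hMove p (l * e) a b)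
    rw [Function.iterate_succ_apply'] at h1
    have h2 := gameStep_le (e := e) (le_gameStep_iterate (e := e) hm n) (hMove p (l * e) a b) hab
    rw [hMove_hMove, hMove_hMove, max_comm] at h2
    have e1 : (l : ℝ) * e + -e = ((l - 1 : ℤ) : ℝ) * e := by push_cast; ring
    have e2 : (l : ℝ) * e + e = ((l + 1 : ℤ) : ℝ) * e := by push_cast; ring
    rw [e1, e2] at h2
    linarith
  have := le_max_of_forall_lt_max_neighbors key (l := -(i : ℤ)) (m := j) (by omega) (by omega)
  simpa [hMove_zero] using this

/-! ### The barrier for the initial condition -/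

/-- The fourth power of the gauge of `p₀⁻¹ · p`. -/
def gauge4 (p₀ p : Heis) : ℝ :=
  ((p.1 - p₀.1) ^ 2 + (p.2.1 - p₀.2.1) ^ 2) ^ 2 +
    16 * (p.2.2 - p₀.2.2 - (p₀.1 * p.2.1 - p.1 * p₀.2.1) / 2) ^ 2

lemma gauge4_nonneg (p₀ p : Heis) : 0 ≤ gauge4 p₀ p := by
  unfold gauge4; positivity

lemma gauge4_self (p : Heis) : gauge4 p p = 0 := by
  simp [gauge4]

lemma continuous_gauge4 (p₀ : Heis) : Continuous (gauge4 p₀) := by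
  unfold gauge4; fun_prop

lemma exists_unit_orthogonal (x y : ℝ) : ∃ a b : ℝ, a ^ 2 + b ^ 2 = 1 ∧ x * a + y * b = 0 := by
  by_cases h : x ^ 2 + y ^ 2 = 0
  · have hx : x = 0 := by nlinarith [sq_nonneg x, sq_nonneg y]
    have hy : y = 0 := by nlinarith [sq_nonneg x, sq_nonneg y]
    exact ⟨1, 0, by norm_num, by simp [hx, hy]⟩
  · have hpos : 0 < x ^ 2 + y ^ 2 := lt_of_le_of_ne (by positivity) (Ne.symm h)
    have hs := Real.sq_sqrt hpos.le
    have hs0 : √(x ^ 2 + y ^ 2) ≠ 0 := (Real.sqrt_pos.2 hpos).ne'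
    refine ⟨-y / √(x ^ 2 + y ^ 2), x / √(x ^ 2 + y ^ 2), ?_, ?_⟩
    · rw [div_pow, div_pow, hs]; field_simp; ring
    · field_simp; ring

lemma gauge4_hMove_le {p₀ p : Heis} {a b s : ℝ} (hab : a ^ 2 + b ^ 2 = 1) (hs : s ^ 2 ≤ 1)
    (horth : ((p.1 - p₀.1) * ((p.1 - p₀.1) ^ 2 + (p.2.1 - p₀.2.1) ^ 2) - 4 * (p.2.1 - p₀.2.1) *
        (p.2.2 - p₀.2.2 - (p₀.1 * p.2.1 - p.1 * p₀.2.1) / 2)) * a +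
      ((p.2.1 - p₀.2.1) * ((p.1 - p₀.1) ^ 2 + (p.2.1 - p₀.2.1) ^ 2) + 4 * (p.1 - p₀.1) *
        (p.2.2 - p₀.2.2 - (p₀.1 * p.2.1 - p.1 * p₀.2.1) / 2)) * b = 0) :
    gauge4 p₀ (hMove p s a b) + 1 ≤ (1 + 8 * s ^ 2) * (gauge4 p₀ p + 1) := by
  obtain ⟨x, y, z⟩ := p
  obtain ⟨x₀, y₀, z₀⟩ := p₀
  simp only [gauge4, hMove] at *
  have hZ : z + s * (x * b - a * y) / 2 - z₀ - (x₀ * (y + s * b) - (x + s * a) * y₀) / 2 =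
      (z - z₀ - (x₀ * y - x * y₀) / 2) + s * ((x - x₀) * b - a * (y - y₀)) / 2 := by ring
  rw [hZ, show x + s * a - x₀ = (x - x₀) + s * a by ring,
    show y + s * b - y₀ = (y - y₀) + s * b by ring]
  generalize z - z₀ - (x₀ * y - x * y₀) / 2 = Z at *
  generalize x - x₀ = X at *
  generalize y - y₀ = Y at *
  set R := X ^ 2 + Y ^ 2 with hR
  set d := X * a + Y * b with hd
  set c := X * b - a * Y with hcdef
  have hR' : (X + s * a) ^ 2 + (Y + s * b) ^ 2 = R + 2 * s * d + s ^ 2 := by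
    rw [hR, hd]; linear_combination s ^ 2 * hab
  have hdc : d ^ 2 + c ^ 2 = R := by
    rw [hR, hd, hcdef]; linear_combination (X ^ 2 + Y ^ 2) * hab
  have ho : R * d + 4 * Z * c = 0 := by rw [hd, hcdef]; linear_combination horth
  rw [hR']
  have e1 : (R + 2 * s * d + s ^ 2) ^ 2 + 16 * (Z + s * c / 2) ^ 2 =
      R ^ 2 + 16 * Z ^ 2 + 6 * R * s ^ 2 + s ^ 4 + 4 * s ^ 3 * d := by
    linear_combination 4 * s * ho + 4 * s ^ 2 * hdc
  rw [e1]
  have hRn : 0 ≤ R := by positivity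
  have h2 : 4 * s ^ 3 * d ≤ 2 * s ^ 2 * (R + s ^ 2) := by
    nlinarith [mul_nonneg (sq_nonneg s) (sq_nonneg (d - s)),
      mul_nonneg (sq_nonneg s) (sq_nonneg c)]
  have h3 : s ^ 2 * s ^ 2 ≤ s ^ 2 * 1 := by gcongr
  nlinarith [mul_nonneg (sq_nonneg s) (sq_nonneg (R - 1)), mul_nonneg (sq_nonneg s) (sq_nonneg Z),
    mul_nonneg (sq_nonneg s) (sq_nonneg R)]

lemma gameStep_iterate_le_barrier {e m c A : ℝ} {f : Heis → ℝ} (p₀ : Heis) (he : e ^ 2 ≤ 1)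
    (hA : 0 ≤ A) (hm : ∀ q, m ≤ f q) (hf : ∀ q, f q ≤ c + A * gauge4 p₀ q) (n : ℕ) (p : Heis) :
    (gameStep e)^[n] f p ≤ c + A * ((1 + 8 * e ^ 2) ^ n * (gauge4 p₀ p + 1) - 1) := by
  induction n generalizing p with
  | zero => simpa using hf p
  | succ n ih =>
    rw [Function.iterate_succ_apply']
    obtain ⟨a, b, hab, horth⟩ := exists_unit_orthogonal
      ((p.1 - p₀.1) * ((p.1 - p₀.1) ^ 2 + (p.2.1 - p₀.2.1) ^ 2) - 4 * (p.2.1 - p₀.2.1) *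
        (p.2.2 - p₀.2.2 - (p₀.1 * p.2.1 - p.1 * p₀.2.1) / 2))
      ((p.2.1 - p₀.2.1) * ((p.1 - p₀.1) ^ 2 + (p.2.1 - p₀.2.1) ^ 2) + 4 * (p.1 - p₀.1) *
        (p.2.2 - p₀.2.2 - (p₀.1 * p.2.1 - p.1 * p₀.2.1) / 2))
    have key : ∀ s : ℝ, s ^ 2 = e ^ 2 → (gameStep e)^[n] f (hMove p s a b) ≤
        c + A * ((1 + 8 * e ^ 2) ^ (n + 1) * (gauge4 p₀ p + 1) - 1) := by
      intro s hs
      refine (ih _).trans ?_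
      have h := gauge4_hMove_le hab (hs ▸ he) horth
      rw [hs] at h
      rw [pow_succ _ n, mul_assoc]
      gcongr
    exact (gameStep_le (le_gameStep_iterate hm n) p hab).trans
      (max_le (key _ rfl) (key _ (by ring)))

/-! ### The upper half-relaxed limit -/

section Relaxed

variable {Z : Type*}

/-- The upper half-relaxed limit of a sequence of functions. -/
def upLim [TopologicalSpace Z] (W : ℕ → Z → ℝ) (z : Z) : ℝ :=
  limsup (fun x : ℕ × Z => W x.1 x.2) (atTop ×ˢ 𝓝 z)

variable {W : ℕ → Z → ℝ} {M c : ℝ} {z : Z}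

lemma isBoundedUnder_le_of_abs_le (hW : ∀ k z, |W k z| ≤ M) (F : Filter (ℕ × Z)) :
    IsBoundedUnder (· ≤ ·) F fun x : ℕ × Z => W x.1 x.2 :=
  isBoundedUnder_of ⟨M, fun x => (abs_le.1 (hW x.1 x.2)).2⟩

lemma isCoboundedUnder_le_of_abs_le (hW : ∀ k z, |W k z| ≤ M) (F : Filter (ℕ × Z)) [NeBot F] :
    IsCoboundedUnder (· ≤ ·) F fun x : ℕ × Z => W x.1 x.2 :=
  IsBoundedUnder.isCoboundedUnder_le
    (isBoundedUnder_of ⟨-M, fun x => (abs_le.1 (hW x.1 x.2)).1⟩)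

variable [TopologicalSpace Z]

lemma eventually_lt_of_upLim_lt (hW : ∀ k z, |W k z| ≤ M) (h : upLim W z < c) :
    ∀ᶠ x : ℕ × Z in atTop ×ˢ 𝓝 z, W x.1 x.2 < c :=
  eventually_lt_of_limsup_lt h (isBoundedUnder_le_of_abs_le hW _)

lemma frequently_of_lt_upLim (hW : ∀ k z, |W k z| ≤ M) (h : c < upLim W z) :
    ∃ᶠ x : ℕ × Z in atTop ×ˢ 𝓝 z, c < W x.1 x.2 :=
  frequently_lt_of_lt_limsup (isCoboundedUnder_le_of_abs_le hW _) h

lemma upLim_le_of_eventually (hW : ∀ k z, |W k z| ≤ M)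
    (h : ∀ᶠ x : ℕ × Z in atTop ×ˢ 𝓝 z, W x.1 x.2 ≤ c) : upLim W z ≤ c :=
  limsup_le_of_le (isCoboundedUnder_le_of_abs_le hW _) h

lemma le_upLim_of_eventually (hW : ∀ k z, |W k z| ≤ M)
    (h : ∀ᶠ x : ℕ × Z in atTop ×ˢ 𝓝 z, c ≤ W x.1 x.2) : c ≤ upLim W z :=
  le_limsup_of_frequently_le h.frequently (isBoundedUnder_le_of_abs_le hW _)

lemma upperSemicontinuous_upLim (hW : ∀ k z, |W k z| ≤ M) : UpperSemicontinuous (upLim W) := by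
  intro z c hc
  obtain ⟨c', h1, h2⟩ := exists_between hc
  obtain ⟨pa, hpa, pb, hpb, h⟩ := eventually_prod_iff.1 (eventually_lt_of_upLim_lt hW h1)
  filter_upwards [eventually_eventually_nhds.2 hpb] with y hy
  refine lt_of_le_of_lt (upLim_le_of_eventually hW ?_) h2
  filter_upwards [hpa.prod_mk hy] with x hx
  exact (h hx.1 hx.2).le

/-- Strict maxima of `upLim W - φ` are limits of approximate maxima of `W k - φ`. -/
lemma exists_approx_max {φ : Z → ℝ} (hW : ∀ k z, |W k z| ≤ M) (hφ : Continuous φ) {B : Set Z}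
    (hB : IsCompact B) (hBz : B ∈ 𝓝 z)
    (hmax : ∀ q ∈ B, q ≠ z → upLim W q - φ q < upLim W z - φ z) {δ : ℕ → ℝ} (hδ : ∀ k, 0 < δ k)
    {N : Set Z} (hN : N ∈ 𝓝 z) (K : ℕ) :
    ∃ k ≥ K, ∃ z' ∈ N, z' ∈ B ∧ ∀ q ∈ B, W k q - φ q ≤ W k z' - φ z' + δ k := by
  obtain ⟨O, hON, hO, hzO⟩ := mem_nhds_iff.1 hN
  set m := upLim W z - φ z with hm
  have hloc : ∃ c < m, ∀ᶠ k in atTop, ∀ q ∈ B \ O, W k q - φ q ≤ c := by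
    refine (hB.diff hO).induction_on
      (p := fun S => ∃ c < m, ∀ᶠ k in atTop, ∀ q ∈ S, W k q - φ q ≤ c) ?_ ?_ ?_ ?_
    · exact ⟨m - 1, by linarith, by simp⟩
    · rintro s t hst ⟨c, hc, h⟩
      exact ⟨c, hc, h.mono fun k hk q hq => hk q (hst hq)⟩
    · rintro s t ⟨c, hc, h⟩ ⟨c', hc', h'⟩
      refine ⟨max c c', max_lt hc hc', ?_⟩
      filter_upwards [h, h'] with k hk hk' q hq
      rcases hq with hq | hq
      · exact (hk q hq).trans (le_max_left _ _)
      · exact (hk' q hq).trans (le_max_right _ _)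
    · intro x hx
      have hxz : x ≠ z := fun h => hx.2 (h ▸ hzO)
      have hlt := hmax x hx.1 hxz
      set η := (m - (upLim W x - φ x)) / 4 with hη
      have hηp : 0 < η := by rw [hη]; linarith
      obtain ⟨pa, hpa, pb, hpb, h⟩ := eventually_prod_iff.1
        (eventually_lt_of_upLim_lt hW (show upLim W x < upLim W x + η by linarith))
      have hφx : ∀ᶠ y in 𝓝 x, φ x - η < φ y := hφ.continuousAt.eventually (lt_mem_nhds (by linarith))
      refine ⟨{y | pb y ∧ φ x - η < φ y}, mem_nhdsWithin_of_mem_nhds (hpb.and hφx), m - η,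
        by linarith, hpa.mono fun k hk q hq => ?_⟩
      have := h hk hq.1
      have := hq.2
      simp only at *
      linarith
  obtain ⟨c, hcm, hc⟩ := hloc
  set η := (m - c) / 2 with hη
  have hηp : 0 < η := by rw [hη]; linarith
  have hfreq := frequently_of_lt_upLim hW (show upLim W z - η < upLim W z by linarith)
  have hev : ∀ᶠ x : ℕ × Z in atTop ×ˢ 𝓝 z,
      (K ≤ x.1 ∧ ∀ q ∈ B \ O, W x.1 q - φ q ≤ c) ∧ (x.2 ∈ B ∧ φ x.2 < φ z + η) :=
    ((eventually_ge_atTop K).and hc).prod_mk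
      ((show ∀ᶠ y in 𝓝 z, y ∈ B from hBz).and
        (hφ.continuousAt.eventually (gt_mem_nhds (by linarith))))
  obtain ⟨⟨k, y⟩, hy, ⟨hK, hk⟩, hyB, hφy⟩ := (hfreq.and_eventually hev).exists
  simp only at hy hK hk hyB hφy
  have hyc : c < W k y - φ y := by linarith
  obtain ⟨Mφ, hMφ⟩ := hB.exists_bound_of_continuousOn hφ.continuousOn
  have hbdd : BddAbove ((fun q => W k q - φ q) '' B) := by
    refine ⟨M + Mφ, ?_⟩
    rintro _ ⟨q, hq, rfl⟩
    have h1 := (abs_le.1 (hW k q)).2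
    have h2 := (abs_le.1 (Real.norm_eq_abs _ ▸ hMφ q hq)).1
    simp only
    linarith
  set S := sSup ((fun q => W k q - φ q) '' B) with hS
  have hyS : W k y - φ y ≤ S := le_csSup hbdd ⟨y, hyB, rfl⟩
  obtain ⟨_, ⟨z', hz', rfl⟩, hlt⟩ := exists_lt_of_lt_csSup
    (s := (fun q => W k q - φ q) '' B) ⟨_, y, hyB, rfl⟩
    (show max c (S - δ k) < S from max_lt (by linarith) (by linarith [hδ k]))
  simp only at hlt
  refine ⟨k, hK, z', ?_, hz', fun q hq => ?_⟩
  · by_contra hz'N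
    have := hk z' ⟨hz', fun h => hz'N (hON h)⟩
    linarith [le_max_left c (S - δ k)]
  · have : W k q - φ q ≤ S := le_csSup hbdd ⟨q, hq, rfl⟩
    linarith [le_max_right c (S - δ k)]

end Relaxed

/-! ### Envelopes of the curvature operator -/

lemma abs_Fcurv_le (ξ : ℝ × ℝ) (A : ℝ × ℝ × ℝ) : |Fcurv ξ A| ≤ 5 * ‖A‖ := by
  have h1 : |A.1| ≤ ‖A‖ := norm_fst_le A
  have h2 : |A.2.1| ≤ ‖A‖ := (norm_fst_le A.2).trans (norm_snd_le A)
  have h3 : |A.2.2| ≤ ‖A‖ := (norm_snd_le A.2).trans (norm_snd_le A)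
  have hq : |(A.1 * ξ.1 ^ 2 + 2 * A.2.1 * ξ.1 * ξ.2 + A.2.2 * ξ.2 ^ 2) / (ξ.1 ^ 2 + ξ.2 ^ 2)| ≤
      3 * ‖A‖ := by
    have hd : 0 ≤ ξ.1 ^ 2 + ξ.2 ^ 2 := by positivity
    rw [abs_div, abs_of_nonneg hd]
    refine div_le_of_le_mul₀ hd (by positivity) ?_
    rw [abs_le] at *
    have hs := sq_nonneg (ξ.1 - ξ.2)
    have ht := sq_nonneg (ξ.1 + ξ.2)
    constructor <;>
    nlinarith [sq_nonneg ξ.1, sq_nonneg ξ.2, mul_nonneg (sub_nonneg.2 h2.2) hs,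
      mul_nonneg (sub_nonneg.2 h2.2) ht, mul_nonneg (neg_le_iff_add_nonneg.1 h2.1) hs,
      mul_nonneg (neg_le_iff_add_nonneg.1 h2.1) ht]
  unfold Fcurv
  rw [abs_le] at *
  constructor <;> linarith [h1.1, h1.2, h3.1, h3.2, hq.1, hq.2]

lemma eventually_abs_Fcurv_le (ξ : ℝ × ℝ) (A : ℝ × ℝ × ℝ) :
    ∀ᶠ q : (ℝ × ℝ) × ℝ × ℝ × ℝ in 𝓝[{q : (ℝ × ℝ) × ℝ × ℝ × ℝ | q.1 ≠ 0}] (ξ, A),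
      |Fcurv q.1 q.2| ≤ 5 * (‖A‖ + 1) := by
  have h : ∀ᶠ q : (ℝ × ℝ) × ℝ × ℝ × ℝ in 𝓝 (ξ, A), ‖q.2‖ < ‖A‖ + 1 :=
    (continuous_snd.norm.tendsto (ξ, A)).eventually (gt_mem_nhds (by simp))
  filter_upwards [mem_nhdsWithin_of_mem_nhds h] with q hq
  exact (abs_Fcurv_le _ _).trans (by linarith [show ‖q.2‖ < ‖A‖ + 1 from hq])

lemma frequently_Fcurv_eq {ξ : ℝ × ℝ} {A : ℝ × ℝ × ℝ} {a b : ℝ} (hab : a ^ 2 + b ^ 2 = 1)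
    (horth : a * ξ.1 + b * ξ.2 = 0) :
    ∃ᶠ q : (ℝ × ℝ) × ℝ × ℝ × ℝ in 𝓝[{q : (ℝ × ℝ) × ℝ × ℝ × ℝ | q.1 ≠ 0}] (ξ, A),
      Fcurv q.1 q.2 = -(A.1 * a ^ 2 + 2 * A.2.1 * a * b + A.2.2 * b ^ 2) := by
  obtain ⟨c, σ, hc1, hc2, hσ⟩ : ∃ c σ : ℝ, ξ.1 = -b * c ∧ ξ.2 = a * c ∧
      ∀ s : ℝ, 0 < s → c + s * σ ≠ 0 := by
    have h1 : ξ.1 = -b * (a * ξ.2 - b * ξ.1) := by linear_combination a * horth - ξ.1 * hab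
    have h2 : ξ.2 = a * (a * ξ.2 - b * ξ.1) := by linear_combination b * horth - ξ.2 * hab
    rcases le_or_gt 0 (a * ξ.2 - b * ξ.1) with h | h
    · exact ⟨_, 1, h1, h2, fun s hs =>
        (show 0 < a * ξ.2 - b * ξ.1 + s * 1 by linarith).ne'⟩
    · exact ⟨_, -1, h1, h2, fun s hs =>
        (show a * ξ.2 - b * ξ.1 + s * -1 < 0 by linarith).ne⟩
  let γ : ℝ → (ℝ × ℝ) × ℝ × ℝ × ℝ := fun s => ((-b * (c + s * σ), a * (c + s * σ)), A)
  have hγ0 : γ 0 = (ξ, A) := by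
    ext <;> simp [γ, hc1, hc2]
  have hγc : Continuous γ := by fun_prop
  have hsq : ∀ s, (-b * (c + s * σ)) ^ 2 + (a * (c + s * σ)) ^ 2 = (c + s * σ) ^ 2 := fun s => by
    linear_combination (c + s * σ) ^ 2 * hab
  have htend : Tendsto γ (𝓝[>] 0) (𝓝[{q : (ℝ × ℝ) × ℝ × ℝ × ℝ | q.1 ≠ 0}] (ξ, A)) := by
    refine tendsto_nhdsWithin_iff.2 ⟨?_, ?_⟩
    · exact (hγ0 ▸ hγc.tendsto 0).mono_left nhdsWithin_le_nhds
    · filter_upwards [self_mem_nhdsWithin] with s hs h0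
      have h1 : -b * (c + s * σ) = 0 := congrArg Prod.fst h0
      have h2 : a * (c + s * σ) = 0 := congrArg Prod.snd h0
      have h3 := hsq s
      rw [h1, h2] at h3
      exact hσ s hs (by nlinarith)
  refine htend.frequently (Eventually.frequently ?_)
  filter_upwards [self_mem_nhdsWithin] with s hs
  have hne := hσ s hs
  simp only [γ, Fcurv]
  rw [hsq s]
  field_simp
  linear_combination (A.1 + A.2.2) * hab

lemma FcurvLower_le {ξ : ℝ × ℝ} {A : ℝ × ℝ × ℝ} {a b : ℝ} (hab : a ^ 2 + b ^ 2 = 1)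
    (horth : a * ξ.1 + b * ξ.2 = 0) :
    FcurvLower ξ A ≤ -(A.1 * a ^ 2 + 2 * A.2.1 * a * b + A.2.2 * b ^ 2) :=
  liminf_le_of_frequently_le ((frequently_Fcurv_eq hab horth).mono fun _ h => h.le)
    ⟨-(5 * (‖A‖ + 1)), eventually_map.2
      ((eventually_abs_Fcurv_le ξ A).mono fun _ h => (abs_le.1 h).1)⟩

lemma le_FcurvUpper {ξ : ℝ × ℝ} {A : ℝ × ℝ × ℝ} {a b : ℝ} (hab : a ^ 2 + b ^ 2 = 1)
    (horth : a * ξ.1 + b * ξ.2 = 0) :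
    -(A.1 * a ^ 2 + 2 * A.2.1 * a * b + A.2.2 * b ^ 2) ≤ FcurvUpper ξ A :=
  le_limsup_of_frequently_le ((frequently_Fcurv_eq hab horth).mono fun _ h => h.ge)
    ⟨5 * (‖A‖ + 1), eventually_map.2
      ((eventually_abs_Fcurv_le ξ A).mono fun _ h => (abs_le.1 h).2)⟩

/-! ### Horizontal calculus for functions of space and time -/

/-- The field `X₁` acting on the space variables of a function of space and time. -/
def spX1 (φ : Heis × ℝ → ℝ) (z : Heis × ℝ) : ℝ :=
  fderiv ℝ φ z ((1, 0, 0), 0) - z.1.2.1 / 2 * fderiv ℝ φ z ((0, 0, 1), 0)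

/-- The field `X₂` acting on the space variables of a function of space and time. -/
def spX2 (φ : Heis × ℝ → ℝ) (z : Heis × ℝ) : ℝ :=
  fderiv ℝ φ z ((0, 1, 0), 0) + z.1.1 / 2 * fderiv ℝ φ z ((0, 0, 1), 0)

/-- The time derivative. -/
def timeDeriv (φ : Heis × ℝ → ℝ) (z : Heis × ℝ) : ℝ := fderiv ℝ φ z (0, 1)

/-- The horizontal Hessian as a quadratic form. -/
def hessForm (φ : Heis × ℝ → ℝ) (z : Heis × ℝ) (a b : ℝ) : ℝ :=
  a * (a * spX1 (spX1 φ) z + b * spX2 (spX1 φ) z) +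
    b * (a * spX1 (spX2 φ) z + b * spX2 (spX2 φ) z)

section Calculus

variable {φ : Heis × ℝ → ℝ}

lemma contDiff_spX1 (hφ : ContDiff ℝ (⊤ : ℕ∞) φ) : ContDiff ℝ (⊤ : ℕ∞) (spX1 φ) := by
  have h := hφ.fderiv_right (m := (⊤ : ℕ∞)) (by simp)
  unfold spX1
  fun_prop

lemma contDiff_spX2 (hφ : ContDiff ℝ (⊤ : ℕ∞) φ) : ContDiff ℝ (⊤ : ℕ∞) (spX2 φ) := by
  have h := hφ.fderiv_right (m := (⊤ : ℕ∞)) (by simp)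
  unfold spX2
  fun_prop

lemma continuous_timeDeriv (hφ : ContDiff ℝ (⊤ : ℕ∞) φ) : Continuous (timeDeriv φ) := by
  have h := (hφ.fderiv_right (m := (⊤ : ℕ∞)) (by simp)).continuous
  unfold timeDeriv
  fun_prop

lemma fderiv_slice (hφ : Differentiable ℝ φ) (p : Heis) (t : ℝ) (h : Heis) :
    fderiv ℝ (fun w => φ (w, t)) p h = fderiv ℝ φ (p, t) (h, 0) := by
  have := (HasFDerivAt.comp (f := fun w : Heis => (w, t)) p (hφ (p, t)).hasFDerivAt
    (hasFDerivAt_prodMk_left p t)).fderiv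
  rw [show (fun w => φ (w, t)) = φ ∘ fun w => (w, t) from rfl, this]
  simp

lemma X1_slice (hφ : Differentiable ℝ φ) (p : Heis) (t : ℝ) :
    X1 (fun w => φ (w, t)) p = spX1 φ (p, t) := by
  simp [X1, spX1, fderiv_slice hφ]

lemma X2_slice (hφ : Differentiable ℝ φ) (p : Heis) (t : ℝ) :
    X2 (fun w => φ (w, t)) p = spX2 φ (p, t) := by
  simp [X2, spX2, fderiv_slice hφ]

lemma gradH_slice (hφ : ContDiff ℝ (⊤ : ℕ∞) φ) (p : Heis) (t : ℝ) :
    gradH (fun w => φ (w, t)) p = (spX1 φ (p, t), spX2 φ (p, t)) := by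
  have h := hφ.differentiable (by simp)
  rw [gradH, X1_slice h, X2_slice h]

lemma hessH_slice (hφ : ContDiff ℝ (⊤ : ℕ∞) φ) (p : Heis) (t : ℝ) :
    hessH (fun w => φ (w, t)) p = (spX1 (spX1 φ) (p, t),
      (spX1 (spX2 φ) (p, t) + spX2 (spX1 φ) (p, t)) / 2, spX2 (spX2 φ) (p, t)) := by
  have h := hφ.differentiable (by simp)
  have h1 := (contDiff_spX1 hφ).differentiable (by simp)
  have h2 := (contDiff_spX2 hφ).differentiable (by simp)
  rw [hessH, funext fun w => X1_slice h w t, funext fun w => X2_slice h w t, X1_slice h1,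
    X1_slice h2, X2_slice h1, X2_slice h2]

lemma hasDerivAt_time (hφ : Differentiable ℝ φ) (p : Heis) (t : ℝ) :
    HasDerivAt (fun s => φ (p, s)) (timeDeriv φ (p, t)) t :=
  (hφ (p, t)).hasFDerivAt.comp_hasDerivAt t ((hasDerivAt_const t p).prodMk (hasDerivAt_id t))

lemma hasDerivAt_hMove (hφ : Differentiable ℝ φ) (p : Heis) (t a b s : ℝ) :
    HasDerivAt (fun s => φ (hMove p s a b, t))
      (a * spX1 φ (hMove p s a b, t) + b * spX2 φ (hMove p s a b, t)) s := by
  have hγ : HasDerivAt (fun s => (hMove p s a b, t))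
      (((a, b, (p.1 * b - a * p.2.1) / 2), 0) : Heis × ℝ) s := by
    refine HasDerivAt.prodMk (HasDerivAt.prodMk ?_ (HasDerivAt.prodMk ?_ ?_)) (hasDerivAt_const _ _)
    · simpa using ((hasDerivAt_id s).mul_const a).const_add p.1
    · simpa using ((hasDerivAt_id s).mul_const b).const_add p.2.1
    · simpa [mul_div_assoc] using
        ((hasDerivAt_id s).mul_const ((p.1 * b - a * p.2.1) / 2)).const_add p.2.2
  have h := (hφ (hMove p s a b, t)).hasFDerivAt.comp_hasDerivAt s hγ
  refine h.congr_deriv ?_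
  have e : (((a, b, (p.1 * b - a * p.2.1) / 2), 0) : Heis × ℝ) =
      a • ((1, 0, 0), 0) + b • ((0, 1, 0), 0) + ((p.1 * b - a * p.2.1) / 2) • ((0, 0, 1), 0) := by
    ext <;> simp
  rw [e, map_add, map_add, map_smul, map_smul, map_smul]
  simp only [spX1, spX2, smul_eq_mul, hMove]
  ring

lemma exists_taylor_two {g g' g'' : ℝ → ℝ} (hg : ∀ s, HasDerivAt g (g' s) s)
    (hg' : ∀ s, HasDerivAt g' (g'' s) s) {e : ℝ} (he : 0 < e) :
    ∃ s ∈ Set.Ioo 0 e, g e = g 0 + e * g' 0 + e ^ 2 / 2 * g'' s := by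
  have hh : ∀ s, HasDerivAt (fun s => g s - g' 0 * s) (g' s - g' 0) s := fun s =>
    ((hg s).sub ((hasDerivAt_id s).const_mul (g' 0))).congr_deriv (by simp)
  have hk : ∀ s : ℝ, HasDerivAt (fun s => s ^ 2) (2 * s) s := fun s => by
    simpa using hasDerivAt_pow 2 s
  obtain ⟨c, hc, h1⟩ := exists_ratio_hasDerivAt_eq_ratio_slope _ _ he
    (fun s _ => (hh s).continuousAt.continuousWithinAt) (fun s _ => hh s) _ _
    (fun s _ => (hk s).continuousAt.continuousWithinAt) (fun s _ => hk s)
  obtain ⟨s, hs, h2⟩ := exists_hasDerivAt_eq_slope g' g'' hc.1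
    (fun s _ => (hg' s).continuousAt.continuousWithinAt) (fun s _ => hg' s)
  have hc0 : c ≠ 0 := hc.1.ne'
  rw [sub_zero, eq_div_iff hc0] at h2
  refine ⟨s, ⟨hs.1, hs.2.trans hc.2⟩, ?_⟩
  rw [← h2] at h1
  have h3 : c * (e ^ 2 * g'' s) = c * (2 * (g e - g' 0 * e - g 0)) := by
    linear_combination h1
  have := mul_left_cancel₀ hc0 h3
  linarith

lemma exists_taylor_hMove (hφ : ContDiff ℝ (⊤ : ℕ∞) φ) (p : Heis) (t a b : ℝ) {e : ℝ}
    (he : 0 < e) :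
    ∃ s ∈ Set.Ioo 0 e, φ (hMove p e a b, t) =
      φ (p, t) + e * (a * spX1 φ (p, t) + b * spX2 φ (p, t)) +
        e ^ 2 / 2 * hessForm φ (hMove p s a b, t) a b := by
  have h := hφ.differentiable (by simp)
  have h1 := (contDiff_spX1 hφ).differentiable (by simp)
  have h2 := (contDiff_spX2 hφ).differentiable (by simp)
  have := exists_taylor_two (fun s => hasDerivAt_hMove h p t a b s)
    (fun s => ((hasDerivAt_hMove h1 p t a b s).const_mul a).add
      ((hasDerivAt_hMove h2 p t a b s).const_mul b)) he
  simpa only [hMove_zero, hessForm] using this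

lemma exists_timeDeriv_eq (hφ : Differentiable ℝ φ) (p : Heis) (t : ℝ) {h : ℝ} (hh : 0 < h) :
    ∃ s ∈ Set.Ioo t (t + h), φ (p, t + h) = φ (p, t) + h * timeDeriv φ (p, s) := by
  obtain ⟨s, hs, h1⟩ := exists_hasDerivAt_eq_slope (fun s => φ (p, s)) (fun s => timeDeriv φ (p, s))
    (show t < t + h by linarith) (fun s _ => (hasDerivAt_time hφ p s).continuousAt.continuousWithinAt)
    (fun s _ => hasDerivAt_time hφ p s)
  refine ⟨s, hs, ?_⟩
  simp only [add_sub_cancel_left] at h1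
  rw [h1]
  field_simp
  ring

lemma continuous_hessForm (hφ : ContDiff ℝ (⊤ : ℕ∞) φ) :
    Continuous fun x : (Heis × ℝ) × ℝ × ℝ => hessForm φ x.1 x.2.1 x.2.2 := by
  have h11 := (contDiff_spX1 (contDiff_spX1 hφ)).continuous
  have h12 := (contDiff_spX1 (contDiff_spX2 hφ)).continuous
  have h21 := (contDiff_spX2 (contDiff_spX1 hφ)).continuous
  have h22 := (contDiff_spX2 (contDiff_spX2 hφ)).continuous
  unfold hessForm
  fun_prop

/-- Passing to the limit in a discrete dynamic programming inequality for a smooth function. -/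
lemma exists_dir_of_discrete (hφ : ContDiff ℝ (⊤ : ℕ∞) φ) (z : Heis × ℝ)
    (h : ∀ γ : ℝ, 0 < γ → ∃ e : ℝ, 0 < e ∧ e < γ ∧ ∃ y : Heis × ℝ, dist y z < γ ∧
      ∃ a b : ℝ, a ^ 2 + b ^ 2 = 1 ∧ a * spX1 φ y + b * spX2 φ y ≤ 0 ∧
        φ (y.1, y.2 + e ^ 2 / 2) ≤ φ (hMove y.1 e a b, y.2) + 2 * e ^ 3) :
    ∃ a b : ℝ, a ^ 2 + b ^ 2 = 1 ∧ a * spX1 φ z + b * spX2 φ z = 0 ∧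
      timeDeriv φ z ≤ hessForm φ z a b := by
  choose e he he' y hy a b hab hD hstep using fun n : ℕ =>
    h (1 / ((n : ℝ) + 1)) (by positivity)
  have hφd := hφ.differentiable (by simp)
  have hcpt : IsCompact {v : ℝ × ℝ | v.1 ^ 2 + v.2 ^ 2 = 1} := by
    refine (isCompact_Icc (a := ((-1, -1) : ℝ × ℝ)) (b := (1, 1))).of_isClosed_subset
      (isClosed_eq (by fun_prop) (by fun_prop)) fun v hv => ?_
    have hv' : v.1 ^ 2 + v.2 ^ 2 = 1 := hv
    refine ⟨⟨?_, ?_⟩, ?_, ?_⟩ <;> simp only <;> nlinarith [sq_nonneg v.1, sq_nonneg v.2]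
  obtain ⟨⟨a₀, b₀⟩, hab₀, ψ, hψ, hlim⟩ := hcpt.tendsto_subseq (x := fun n => (a n, b n)) hab
  have hzero : Tendsto (fun n : ℕ => 1 / ((ψ n : ℝ) + 1)) atTop (𝓝 0) :=
    tendsto_one_div_add_atTop_nhds_zero_nat.comp hψ.tendsto_atTop
  have ha : Tendsto (fun n => a (ψ n)) atTop (𝓝 a₀) := (continuous_fst.tendsto _).comp hlim
  have hb : Tendsto (fun n => b (ψ n)) atTop (𝓝 b₀) := (continuous_snd.tendsto _).comp hlim
  have he0 : Tendsto (fun n => e (ψ n)) atTop (𝓝 0) :=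
    squeeze_zero (fun n => (he _).le) (fun n => (he' _).le) hzero
  have hyz : Tendsto (fun n => y (ψ n)) atTop (𝓝 z) :=
    tendsto_iff_dist_tendsto_zero.2
      (squeeze_zero (fun n => dist_nonneg) (fun n => (hy _).le) hzero)
  choose s hs hsT using fun n => exists_taylor_hMove hφ (y n).1 (y n).2 (a n) (b n) (he n)
  choose τ hτ hτT using fun n => exists_timeDeriv_eq hφd (y n).1 (y n).2
    (show 0 < e n ^ 2 / 2 by have := he n; positivity)
  have hs0 : Tendsto (fun n => s (ψ n)) atTop (𝓝 0) :=
    squeeze_zero (fun n => (hs _).1.le) (fun n => (hs _).2.le) he0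
  have hy1 : Tendsto (fun n => (y (ψ n)).1) atTop (𝓝 z.1) := (continuous_fst.tendsto _).comp hyz
  have hy2 : Tendsto (fun n => (y (ψ n)).2) atTop (𝓝 z.2) := (continuous_snd.tendsto _).comp hyz
  have hτ0 : Tendsto (fun n => τ (ψ n)) atTop (𝓝 z.2) := by
    refine tendsto_of_tendsto_of_tendsto_of_le_of_le hy2
      (h := fun n => (y (ψ n)).2 + e (ψ n) ^ 2 / 2) ?_ (fun n => (hτ _).1.le) (fun n => (hτ _).2.le)
    simpa using hy2.add ((he0.pow 2).div_const 2)
  have hDt : Tendsto (fun n => timeDeriv φ ((y (ψ n)).1, τ (ψ n))) atTop (𝓝 (timeDeriv φ z)) :=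
    ((continuous_timeDeriv hφ).tendsto z).comp (hy1.prodMk_nhds hτ0)
  have hmove : Tendsto (fun n => hMove (y (ψ n)).1 (s (ψ n)) (a (ψ n)) (b (ψ n))) atTop
      (𝓝 z.1) := by
    have := (continuous_hMove.tendsto (z.1, 0, a₀, b₀)).comp
      (hy1.prodMk_nhds (hs0.prodMk_nhds (ha.prodMk_nhds hb)))
    rw [hMove_zero] at this
    exact this
  have hQ : Tendsto (fun n => hessForm φ
      (hMove (y (ψ n)).1 (s (ψ n)) (a (ψ n)) (b (ψ n)), (y (ψ n)).2) (a (ψ n)) (b (ψ n))) atTop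
      (𝓝 (hessForm φ z a₀ b₀)) :=
    ((continuous_hessForm hφ).tendsto (z, a₀, b₀)).comp
      ((hmove.prodMk_nhds hy2).prodMk_nhds (ha.prodMk_nhds hb))
  have hDlim : Tendsto (fun n => a (ψ n) * spX1 φ (y (ψ n)) + b (ψ n) * spX2 φ (y (ψ n))) atTop
      (𝓝 (a₀ * spX1 φ z + b₀ * spX2 φ z)) :=
    (ha.mul (((contDiff_spX1 hφ).continuous.tendsto z).comp hyz)).add
      (hb.mul (((contDiff_spX2 hφ).continuous.tendsto z).comp hyz))
  have hineq : ∀ n, e n * (e n / 2 * (timeDeriv φ ((y n).1, τ n) -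
      hessForm φ (hMove (y n).1 (s n) (a n) (b n), (y n).2) (a n) (b n)) - 2 * e n ^ 2) ≤
      e n * (a n * spX1 φ (y n) + b n * spX2 φ (y n)) := by
    intro n
    have h1 := hstep n
    rw [hsT n, hτT n] at h1
    have h2 : φ ((y n).1, (y n).2) = φ (y n) := rfl
    simp only [Prod.mk.eta] at *
    nlinarith
  refine ⟨a₀, b₀, hab₀, le_antisymm (le_of_tendsto' hDlim fun n => hD _) ?_, ?_⟩
  · have hl : Tendsto (fun n => e (ψ n) / 2 * (timeDeriv φ ((y (ψ n)).1, τ (ψ n)) -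
        hessForm φ (hMove (y (ψ n)).1 (s (ψ n)) (a (ψ n)) (b (ψ n)), (y (ψ n)).2) (a (ψ n))
          (b (ψ n))) - 2 * e (ψ n) ^ 2) atTop (𝓝 0) := by
      simpa using ((he0.div_const 2).mul (hDt.sub hQ)).sub ((he0.pow 2).const_mul 2)
    exact le_of_tendsto_of_tendsto' hl hDlim fun n => le_of_mul_le_mul_left (hineq _) (he _)
  · have hr := hQ.add (he0.const_mul 4)
    rw [mul_zero, add_zero] at hr
    refine le_of_tendsto_of_tendsto' hDt hr fun n => ?_
    have h1 := le_of_mul_le_mul_left (hineq (ψ n)) (he _)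
    have h2 := hD (ψ n)
    have h3 := he (ψ n)
    refine le_of_mul_le_mul_left ?_ h3
    nlinarith

end Calculus

/-! ### Game values and their half-relaxed limits -/

/-- The spatial step of the `k`-th game. -/
def stepSize (k : ℕ) : ℝ := 1 / ((k : ℝ) + 1)

lemma stepSize_pos (k : ℕ) : 0 < stepSize k := by unfold stepSize; positivity

lemma stepSize_le_one (k : ℕ) : stepSize k ≤ 1 := by
  unfold stepSize
  rw [div_le_one (by positivity)]
  linarith [k.cast_nonneg (α := ℝ)]

lemma tendsto_stepSize : Tendsto stepSize atTop (𝓝 0) := tendsto_one_div_add_atTop_nhds_zero_nat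

/-- The value function of the `k`-th game with terminal cost `u₀`. -/
def gameVal (u₀ : Heis → ℝ) (k : ℕ) (z : Heis × ℝ) : ℝ :=
  (gameStep (stepSize k))^[⌊z.2 / (stepSize k ^ 2 / 2)⌋₊] u₀ z.1

lemma gameVal_eq_gameStep (u₀ : Heis → ℝ) (k : ℕ) {z : Heis × ℝ} (hz : stepSize k ^ 2 / 2 ≤ z.2) :
    gameVal u₀ k z =
      gameStep (stepSize k) (fun p => gameVal u₀ k (p, z.2 - stepSize k ^ 2 / 2)) z.1 := by
  have hpos : 0 < stepSize k ^ 2 / 2 := by have := stepSize_pos k; positivity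
  have h : z.2 / (stepSize k ^ 2 / 2) =
      (z.2 - stepSize k ^ 2 / 2) / (stepSize k ^ 2 / 2) + 1 := by
    rw [sub_div, div_self hpos.ne', sub_add_cancel]
  unfold gameVal
  rw [h, Nat.floor_add_one (div_nonneg (by linarith) hpos.le), Function.iterate_succ_apply']

/-- The lower half-relaxed limit of a sequence of functions. -/
def lowLim {Z : Type*} [TopologicalSpace Z] (W : ℕ → Z → ℝ) (z : Z) : ℝ :=
  -upLim (fun k q => -W k q) z

lemma lowerSemicontinuous_lowLim {Z : Type*} [TopologicalSpace Z] {W : ℕ → Z → ℝ} {M : ℝ}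
    (hW : ∀ k z, |W k z| ≤ M) : LowerSemicontinuous (lowLim W) := by
  intro z c hc
  have h := upperSemicontinuous_upLim (W := fun k q => -W k q) (fun k z => by simpa using hW k z) z
    (-c) (by unfold lowLim at hc; linarith)
  filter_upwards [h] with q hq
  unfold lowLim
  linarith

lemma exists_stencil (z : Heis × ℝ) {O : Set (Heis × ℝ)} (hO : O ∈ 𝓝 z) :
    ∃ δ > 0, ∀ z' : Heis × ℝ, dist z' z < δ → ∀ e : ℝ, |e| < δ → |e| ≤ 1 →
      (z'.1, z'.2 - e ^ 2 / 2) ∈ O ∧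
        ∀ a b : ℝ, a ^ 2 + b ^ 2 = 1 → (hMove z'.1 e a b, z'.2 - e ^ 2 / 2) ∈ O := by
  let Γ : (Heis × ℝ) × ℝ × ℝ × ℝ → Heis × ℝ := fun x =>
    (hMove x.1.1 1 x.2.1 x.2.2.1, x.1.2 - x.2.2.2)
  have hΓ : Continuous Γ := by unfold Γ hMove; fun_prop
  have hΓ0 : Γ (z, 0, 0, 0) = z := by ext <;> simp [Γ, hMove]
  obtain ⟨δ, hδ, h⟩ := Metric.mem_nhds_iff.1
    (hΓ.continuousAt (x := (z, 0, 0, 0)) (by rw [hΓ0]; exact hO))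
  have key : ∀ z' : Heis × ℝ, dist z' z < δ → ∀ c d s : ℝ, |c| < δ → |d| < δ → |s| < δ →
      Γ (z', c, d, s) ∈ O := by
    intro z' hz' c d s hc hd hs
    apply h
    simp only [Metric.mem_ball, Prod.dist_eq, max_lt_iff, Real.dist_eq, sub_zero] at *
    exact ⟨hz', hc, hd, hs⟩
  refine ⟨δ, hδ, fun z' hz' e he he1 => ?_⟩
  have hs : |e ^ 2 / 2| < δ := by
    rw [abs_of_nonneg (by positivity), ← sq_abs]
    nlinarith [abs_nonneg e]
  refine ⟨?_, fun a b hab => ?_⟩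
  · have := key z' hz' 0 0 _ (by simpa using hδ) (by simpa using hδ) hs
    simpa [Γ, hMove] using this
  · have ha : |a| ≤ 1 := abs_le_one_iff_mul_self_le_one.2 (by nlinarith [sq_nonneg b])
    have hb : |b| ≤ 1 := abs_le_one_iff_mul_self_le_one.2 (by nlinarith [sq_nonneg a])
    have hea : |e * a| < δ := by rw [abs_mul]; nlinarith [abs_nonneg e]
    have heb : |e * b| < δ := by rw [abs_mul]; nlinarith [abs_nonneg e]
    have := key z' hz' _ _ _ hea heb hs
    convert this using 2
    ext <;> simp [hMove]
    ring

/-- At a strict maximum point of `upLim W - φ` there are, at arbitrarily small scales, approximate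
maxima of `W k - φ` which see their whole stencil. -/
lemma exists_approx_max_stencil {W : ℕ → Heis × ℝ → ℝ} {M : ℝ} (hW : ∀ k z, |W k z| ≤ M)
    {φ : Heis × ℝ → ℝ} (hφ : Continuous φ) {z : Heis × ℝ} (hz : 0 < z.2)
    {U : Set (Heis × ℝ)} (hU : U ∈ 𝓝 z)
    (hmax : ∀ q ∈ U, 0 < q.2 → q ≠ z → upLim W q - φ q < upLim W z - φ z) {γ : ℝ} (hγ : 0 < γ) :
    ∃ k : ℕ, stepSize k < γ ∧ ∃ y : Heis × ℝ, dist y z < γ ∧ 0 < y.2 ∧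
      ∀ s : ℝ, |s| = stepSize k → ∀ a b : ℝ, a ^ 2 + b ^ 2 = 1 →
        W k (hMove y.1 s a b, y.2) - φ (hMove y.1 s a b, y.2) ≤
          W k (y.1, y.2 + stepSize k ^ 2 / 2) - φ (y.1, y.2 + stepSize k ^ 2 / 2) +
            stepSize k ^ 3 := by
  have hpos : {q : Heis × ℝ | 0 < q.2} ∈ 𝓝 z :=
    (isOpen_lt continuous_const continuous_snd).mem_nhds hz
  obtain ⟨B, hBz, hBU, hB⟩ := local_compact_nhds (inter_mem hU hpos)
  obtain ⟨δ, hδ, hst⟩ := exists_stencil z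
    (inter_mem (inter_mem hBz (Metric.ball_mem_nhds z hγ)) hpos)
  obtain ⟨K, hK⟩ := eventually_atTop.1
    (tendsto_stepSize.eventually (gt_mem_nhds (lt_min hδ hγ)))
  obtain ⟨k, hk, z', hz', -, h⟩ := exists_approx_max hW hφ hB hBz
    (fun q hq hne => hmax q (hBU hq).1 (hBU hq).2 hne)
    (fun k => pow_pos (stepSize_pos k) 3) (Metric.ball_mem_nhds z hδ) K
  have hkδ := hK k hk
  have hstk : ∀ s : ℝ, |s| = stepSize k → _ := fun s hs =>
    hst z' hz' s (hs ▸ hkδ.trans_le (min_le_left _ _)) (hs ▸ stepSize_le_one k)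
  have hs2 : ∀ s : ℝ, |s| = stepSize k → s ^ 2 = stepSize k ^ 2 := fun s hs => by
    rw [← sq_abs, hs]
  have h0 := (hstk _ (abs_of_pos (stepSize_pos k))).1
  refine ⟨k, hkδ.trans_le (min_le_right _ _), (z'.1, z'.2 - stepSize k ^ 2 / 2), h0.1.2, h0.2,
    fun s hs a b hab => ?_⟩
  have h1 := ((hstk s hs).2 a b hab).1.1
  rw [hs2 s hs] at h1
  simpa using h _ h1

section Limits

variable {u₀ : Heis → ℝ} {m C : ℝ}

lemma abs_gameVal_le (hm : ∀ q, m ≤ u₀ q) (hC : ∀ q, u₀ q ≤ C) (k : ℕ) (z : Heis × ℝ) :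
    |gameVal u₀ k z| ≤ max |m| |C| :=
  abs_le_max_abs_abs (le_gameStep_iterate hm _ _) (gameStep_iterate_le hm hC _ _)

lemma flowSubsolution_upLim_gameVal (hm : ∀ q, m ≤ u₀ q) (hC : ∀ q, u₀ q ≤ C) :
    FlowSubsolution (upLim (gameVal u₀)) := by
  rintro φ hφ p t ht ⟨U, hU, hmax⟩
  have hφd := hφ.differentiable (by simp)
  obtain ⟨a, b, hab, hD, hT⟩ := exists_dir_of_discrete hφ (p, t) fun γ hγ => by
    obtain ⟨k, hk, y, hy, hy0, h⟩ := exists_approx_max_stencil (abs_gameVal_le hm hC) hφ.continuous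
      ht hU hmax hγ
    have hdpp := gameVal_eq_gameStep u₀ k (z := (y.1, y.2 + stepSize k ^ 2 / 2))
      (by simp only; linarith)
    simp only [add_sub_cancel_right] at hdpp
    obtain ⟨a, b, hab, hD⟩ := exists_unit_orthogonal (spX1 φ y) (spX2 φ y)
    have hle := gameStep_le (e := stepSize k) (f := fun p => gameVal u₀ k (p, y.2))
      (fun q => le_gameStep_iterate hm _ _) y.1 hab
    rw [← hdpp] at hle
    have he := stepSize_pos k
    have he3 : 0 < stepSize k ^ 3 := by positivity
    refine ⟨stepSize k, he, hk, y, hy, ?_⟩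
    rcases le_max_iff.1 hle with hle | hle
    · have h1 := h _ (abs_of_pos he) a b hab
      exact ⟨a, b, hab, by linarith, by linarith⟩
    · have h1 := h (-stepSize k) (by rw [abs_neg, abs_of_pos he]) a b hab
      refine ⟨-a, -b, by linarith [neg_sq a, neg_sq b], by linarith, ?_⟩
      rw [hMove_neg_neg]
      linarith
  rw [(hasDerivAt_time hφd p t).deriv, gradH_slice hφ, hessH_slice hφ]
  have hF := FcurvLower_le (ξ := (spX1 φ (p, t), spX2 φ (p, t))) (A := (spX1 (spX1 φ) (p, t),
      (spX1 (spX2 φ) (p, t) + spX2 (spX1 φ) (p, t)) / 2, spX2 (spX2 φ) (p, t))) hab hD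
  simp only [hessForm] at hT hF
  linarith

lemma spX1_neg (φ : Heis × ℝ → ℝ) : spX1 (fun z => -φ z) = fun z => -spX1 φ z := by
  funext z
  simp only [spX1, fderiv_fun_neg, neg_apply]
  ring

lemma spX2_neg (φ : Heis × ℝ → ℝ) : spX2 (fun z => -φ z) = fun z => -spX2 φ z := by
  funext z
  simp only [spX2, fderiv_fun_neg, neg_apply]
  ring

lemma timeDeriv_neg (φ : Heis × ℝ → ℝ) (z : Heis × ℝ) :
    timeDeriv (fun z => -φ z) z = -timeDeriv φ z := by
  simp only [timeDeriv, fderiv_fun_neg, neg_apply]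

lemma flowSupersolution_lowLim_gameVal (hm : ∀ q, m ≤ u₀ q) (hC : ∀ q, u₀ q ≤ C) :
    FlowSupersolution (lowLim (gameVal u₀)) := by
  rintro φ hφ p t ht ⟨U, hU, hmin⟩
  have hφd := hφ.differentiable (by simp)
  obtain ⟨a, b, hab, hD, hT⟩ := exists_dir_of_discrete hφ.neg (p, t) fun γ hγ => by
    obtain ⟨k, hk, y, hy, hy0, h⟩ := exists_approx_max_stencil (W := fun k q => -gameVal u₀ k q)
      (fun k z => (abs_neg _).trans_le (abs_gameVal_le hm hC k z)) hφ.neg.continuous ht hU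
      (fun q hq hq0 hne => by
        have := hmin q hq hq0 hne
        simp only [lowLim] at this
        linarith) hγ
    have hdpp := gameVal_eq_gameStep u₀ k (z := (y.1, y.2 + stepSize k ^ 2 / 2))
      (by simp only; linarith)
    simp only [add_sub_cancel_right] at hdpp
    have he := stepSize_pos k
    have he3 : 0 < stepSize k ^ 3 := by positivity
    obtain ⟨a, b, hab, h1, h2⟩ := exists_of_gameStep_lt (e := stepSize k)
      (f := fun p => gameVal u₀ k (p, y.2)) (p := y.1)
      (c := gameVal u₀ k (y.1, y.2 + stepSize k ^ 2 / 2) + stepSize k ^ 3) (by rw [← hdpp]; linarith)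
    have h3 := h _ (abs_of_pos he) a b hab
    have h4 := h (-stepSize k) (by rw [abs_neg, abs_of_pos he]) a b hab
    refine ⟨stepSize k, he, hk, y, hy, ?_⟩
    rcases le_total (a * spX1 (fun z => -φ z) y + b * spX2 (fun z => -φ z) y) 0 with hD | hD
    · exact ⟨a, b, hab, hD, by linarith⟩
    · refine ⟨-a, -b, by linarith [neg_sq a, neg_sq b], by linarith, ?_⟩
      rw [hMove_neg_neg]
      linarith
  rw [(hasDerivAt_time hφd p t).deriv, gradH_slice hφ, hessH_slice hφ]
  simp only [hessForm, spX1_neg, spX2_neg, timeDeriv_neg] at hT hD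
  have hF := le_FcurvUpper (ξ := (spX1 φ (p, t), spX2 φ (p, t))) (A := (spX1 (spX1 φ) (p, t),
      (spX1 (spX2 φ) (p, t) + spX2 (spX1 φ) (p, t)) / 2, spX2 (spX2 φ) (p, t))) hab (by linarith)
  simp only at hF
  linarith

lemma le_upLim_gameVal_and_le_lowLim (hc : Continuous u₀) (hm : ∀ q, m ≤ u₀ q)
    (hC : ∀ q, u₀ q ≤ C)
    (hlow : ∀ η > 0, ∀ᶠ k in atTop, ∀ z : Heis × ℝ, u₀ z.1 - η ≤ gameVal u₀ k z) (z : Heis × ℝ) :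
    u₀ z.1 ≤ upLim (gameVal u₀) z ∧ u₀ z.1 ≤ lowLim (gameVal u₀) z := by
  have key : ∀ η > 0, ∀ᶠ x : ℕ × (Heis × ℝ) in atTop ×ˢ 𝓝 z,
      u₀ z.1 - η ≤ gameVal u₀ x.1 x.2 := by
    intro η hη
    have h1 : ∀ᶠ q : Heis × ℝ in 𝓝 z, u₀ z.1 - η / 2 < u₀ q.1 :=
      (hc.comp continuous_fst).continuousAt.eventually (lt_mem_nhds (by simp; linarith))
    filter_upwards [(hlow (η / 2) (by linarith)).prod_mk h1] with x hx
    linarith [hx.1 x.2, hx.2]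
  refine ⟨le_of_forall_pos_le_add fun η hη => ?_, le_of_forall_pos_le_add fun η hη => ?_⟩
  · linarith [le_upLim_of_eventually (abs_gameVal_le hm hC) (key η hη)]
  · have := upLim_le_of_eventually (W := fun k q => -gameVal u₀ k q) (c := -(u₀ z.1 - η))
      (fun k z => (abs_neg _).trans_le (abs_gameVal_le hm hC k z)) ((key η hη).mono fun x hx => neg_le_neg hx)
    unfold lowLim
    linarith

lemma exists_gauge4_barrier (hc : Continuous u₀) (hC : ∀ q, u₀ q ≤ C) (p : Heis) {η : ℝ}
    (hη : 0 < η) : ∃ A : ℝ, 0 ≤ A ∧ ∀ q, u₀ q ≤ u₀ p + η + A * gauge4 p q := by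
  have hcont : Continuous fun w : Heis => u₀ (hMul p w) := by
    unfold hMul; fun_prop
  have h0 : hMul p 0 = p := by ext <;> simp [hMul]
  obtain ⟨δ, hδ, h⟩ := Metric.mem_nhds_iff.1 (hcont.continuousAt.eventually
    (gt_mem_nhds (show u₀ (hMul p 0) < u₀ p + η by rw [h0]; linarith)))
  have hδ' : 0 < min (δ ^ 4) (16 * δ ^ 2) := by positivity
  refine ⟨(C - u₀ p) / min (δ ^ 4) (16 * δ ^ 2), div_nonneg (by linarith [hC p]) hδ'.le,
    fun q => ?_⟩
  have hG := gauge4_nonneg p q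
  rcases lt_or_ge (gauge4 p q) (min (δ ^ 4) (16 * δ ^ 2)) with hlt | hge
  · obtain ⟨h1, h2⟩ := lt_min_iff.1 hlt
    unfold gauge4 at h1 h2
    have hR : (q.1 - p.1) ^ 2 + (q.2.1 - p.2.1) ^ 2 < δ ^ 2 := by
      refine lt_of_pow_lt_pow_left₀ 2 (by positivity) ?_
      nlinarith [sq_nonneg (q.2.2 - p.2.2 - (p.1 * q.2.1 - q.1 * p.2.1) / 2)]
    have hX : |q.1 - p.1| < δ := abs_lt_of_sq_lt_sq (by nlinarith [sq_nonneg (q.2.1 - p.2.1)]) hδ.le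
    have hY : |q.2.1 - p.2.1| < δ := abs_lt_of_sq_lt_sq (by nlinarith [sq_nonneg (q.1 - p.1)]) hδ.le
    have hZ : |q.2.2 - p.2.2 - (p.1 * q.2.1 - q.1 * p.2.1) / 2| < δ :=
      abs_lt_of_sq_lt_sq
        (by nlinarith [sq_nonneg ((q.1 - p.1) ^ 2 + (q.2.1 - p.2.1) ^ 2)]) hδ.le
    have hmem : ((q.1 - p.1, q.2.1 - p.2.1, q.2.2 - p.2.2 - (p.1 * q.2.1 - q.1 * p.2.1) / 2) :
        Heis) ∈ Metric.ball (0 : Heis) δ := by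
      simp only [Metric.mem_ball, Prod.dist_eq, max_lt_iff, Real.dist_eq, Prod.fst_zero,
        Prod.snd_zero, sub_zero]
      exact ⟨hX, hY, hZ⟩
    have h3 := h hmem
    have hq : hMul p (q.1 - p.1, q.2.1 - p.2.1,
        q.2.2 - p.2.2 - (p.1 * q.2.1 - q.1 * p.2.1) / 2) = q := by
      ext <;> simp [hMul]
      ring
    simp only [Set.mem_ofPred_eq, hq] at h3
    have : 0 ≤ (C - u₀ p) / min (δ ^ 4) (16 * δ ^ 2) * gauge4 p q :=
      mul_nonneg (div_nonneg (by linarith [hC p]) hδ'.le) hG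
    linarith
  · have : C - u₀ p ≤ (C - u₀ p) / min (δ ^ 4) (16 * δ ^ 2) * gauge4 p q := by
      rw [div_mul_eq_mul_div, le_div_iff₀ hδ']
      exact mul_le_mul_of_nonneg_left hge (by linarith [hC p])
    linarith [hC q]

lemma upLim_gameVal_zero_le (hc : Continuous u₀) (hm : ∀ q, m ≤ u₀ q) (hC : ∀ q, u₀ q ≤ C)
    (p : Heis) : upLim (gameVal u₀) (p, 0) ≤ u₀ p := by
  refine le_of_forall_pos_le_add fun η hη => ?_
  obtain ⟨A, hA, hbar⟩ := exists_gauge4_barrier hc hC p (half_pos hη)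
  have hval : ∀ k (z : Heis × ℝ), gameVal u₀ k z ≤
      u₀ p + η / 2 + A * (Real.exp (16 * |z.2|) * (gauge4 p z.1 + 1) - 1) := by
    intro k z
    have he := stepSize_pos k
    have hpos : 0 < stepSize k ^ 2 / 2 := by positivity
    refine (gameStep_iterate_le_barrier p (pow_le_one₀ he.le (stepSize_le_one k)) hA hm hbar _
      _).trans ?_
    have hG := gauge4_nonneg p z.1
    gcongr
    set n := ⌊z.2 / (stepSize k ^ 2 / 2)⌋₊ with hn
    have hn' : (n : ℝ) ≤ |z.2| / (stepSize k ^ 2 / 2) := by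
      refine le_trans ?_ (Nat.floor_le (by positivity))
      exact_mod_cast Nat.floor_le_floor (by gcongr; exact le_abs_self _)
    rw [le_div_iff₀ hpos] at hn'
    calc (1 + 8 * stepSize k ^ 2) ^ n ≤ Real.exp (8 * stepSize k ^ 2) ^ n := by
          gcongr
          rw [add_comm]
          exact Real.add_one_le_exp _
      _ = Real.exp (n * (8 * stepSize k ^ 2)) := (Real.exp_nat_mul _ _).symm
      _ ≤ Real.exp (16 * |z.2|) := Real.exp_le_exp.2 (by linarith)
  have hcont : Continuous fun z : Heis × ℝ =>
      u₀ p + η / 2 + A * (Real.exp (16 * |z.2|) * (gauge4 p z.1 + 1) - 1) := by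
    have := continuous_gauge4 p
    fun_prop
  have hev : ∀ᶠ z : Heis × ℝ in 𝓝 (p, 0),
      u₀ p + η / 2 + A * (Real.exp (16 * |z.2|) * (gauge4 p z.1 + 1) - 1) < u₀ p + η :=
    hcont.continuousAt.eventually (gt_mem_nhds (by simp [gauge4_self]; linarith))
  refine upLim_le_of_eventually (abs_gameVal_le hm hC) ?_
  filter_upwards [tendsto_snd.eventually hev] with x hx
  exact (hval _ _).trans hx.le

end Limits

/-! ### Approximate quasiconvexity of the game values -/

lemma add_le_gameStep_of_uniformly {f : Heis → ℝ} {r₀ lam e : ℝ}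
    (hf : UniformlyHQuasiconvexOn f Set.univ r₀ lam) (he : 0 < e) (her : e < r₀) (p : Heis) :
    f p + lam * e ^ 2 ≤ gameStep e f p := by
  refine le_gameStep fun a b hab => ?_
  have h := hf e he her p trivial (a, b, 0) (by simp [horiz]) hab trivial trivial
  rw [hMul_smul_horiz, hMul_neg_smul_horiz] at h
  linarith

lemma sub_le_gameStep_iterate_of_uniformly {f u₀ : Heis → ℝ} {r₀ lam e m C η : ℝ} (hlam : 0 < lam)
    (hf : UniformlyHQuasiconvexOn f Set.univ r₀ lam) (he : 0 < e) (her : e < r₀)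
    (hm : ∀ q, m ≤ f q) (hm' : ∀ q, m ≤ min (f q) C) (h1 : ∀ q, u₀ q ≤ min (f q) C + η)
    (h2 : ∀ q, min (f q) C ≤ u₀ q + η) (n : ℕ) (p : Heis) :
    u₀ p - 2 * η ≤ (gameStep e)^[n] u₀ p := by
  have hmono : f p ≤ (gameStep e)^[n] f p := by
    induction n with
    | zero => rfl
    | succ n ih =>
      have hc : 0 < lam * e ^ 2 := by positivity
      linarith [gameStep_iterate_add_le_succ hm (add_le_gameStep_of_uniformly hf he her) n p]
  have h3 := gameStep_iterate_le_add (e := e) hm' h2 n p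
  rw [gameStep_iterate_min hm] at h3
  have h4 : min (f p) C ≤ min ((gameStep e)^[n] f p) C := min_le_min_right _ hmono
  linarith [h1 p]

lemma gameStep_iterate_quasiconvex_of_uniformly {f u₀ : Heis → ℝ} {r₀ lam e m C η : ℝ}
    (hlam : 0 < lam) (hf : UniformlyHQuasiconvexOn f Set.univ r₀ lam) (he : 0 < e) (her : e < r₀)
    (hm : ∀ q, m ≤ f q) (hm' : ∀ q, m ≤ min (f q) C) (hmu : ∀ q, m ≤ u₀ q)
    (h1 : ∀ q, u₀ q ≤ min (f q) C + η) (h2 : ∀ q, min (f q) C ≤ u₀ q + η) (n : ℕ) (p : Heis)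
    {a b : ℝ} (hab : a ^ 2 + b ^ 2 = 1) (i j : ℕ) :
    (gameStep e)^[n] u₀ p ≤ max ((gameStep e)^[n] u₀ (hMove p (-(i * e)) a b))
      ((gameStep e)^[n] u₀ (hMove p (j * e) a b)) + 2 * η := by
  have h3 := gameStep_iterate_le_add (e := e) hmu h1 n p
  have h4 := gameStep_iterate_le_add (e := e) hm' h2 n
  rw [gameStep_iterate_min hm] at h3
  have hq := gameStep_iterate_quasiconvex (show 0 < lam * e ^ 2 by positivity) hm
    (add_le_gameStep_of_uniformly hf he her) n p hab i j
  have h5 := min_le_min_right C hq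
  rw [min_max_distrib_right, ← gameStep_iterate_min hm n (hMove p (-(i * e)) a b),
    ← gameStep_iterate_min hm n (hMove p (j * e) a b)] at h5
  have h6 := max_le_max (h4 (hMove p (-(i * e)) a b)) (h4 (hMove p (j * e) a b))
  rw [max_add_add_right] at h6
  linarith

lemma exists_lower_bound {f : Heis → ℝ} (hf : Continuous f) {K : Set Heis} (hK : IsCompact K)
    {C : ℝ} (hout : ∀ p ∉ K, f p = C) : ∃ m, ∀ p, m ≤ f p := by
  obtain ⟨M, hM⟩ := hK.exists_bound_of_continuousOn hf.continuousOn
  refine ⟨min (-M) C, fun p => ?_⟩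
  by_cases hp : p ∈ K
  · exact (min_le_left _ _).trans (abs_le.1 (Real.norm_eq_abs _ ▸ hM p hp)).1
  · exact (min_le_right _ _).trans (hout p hp).ge

lemma tendsto_floor_div_stepSize_mul {s : ℝ} (hs : 0 ≤ s) :
    Tendsto (fun k => (⌊s / stepSize k⌋₊ : ℝ) * stepSize k) atTop (𝓝 s) := by
  refine tendsto_of_tendsto_of_tendsto_of_le_of_le (g := fun k => s - stepSize k) (h := fun _ => s)
    ?_ tendsto_const_nhds (fun k => ?_) (fun k => ?_)
  · simpa using tendsto_const_nhds.sub tendsto_stepSize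
  · have he := stepSize_pos k
    have h := Nat.lt_floor_add_one (s / stepSize k)
    rw [div_lt_iff₀ he] at h
    simp only
    linarith
  · have he := stepSize_pos k
    have h := Nat.floor_le (div_nonneg hs he.le)
    rwa [le_div_iff₀ he] at h

/-- Points of horizontal segments in terms of unit-speed horizontal lines. -/
lemma exists_hMove_of_mem_hSeg {p q w : Heis} (hq : q ∈ hPlane p) (hw : w ∈ hSeg p q) :
    ∃ a b s s' : ℝ, a ^ 2 + b ^ 2 = 1 ∧ 0 ≤ s ∧ 0 ≤ s' ∧ p = hMove w (-s) a b ∧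
      q = hMove w s' a b := by
  obtain ⟨⟨c, d, f⟩, hh, rfl⟩ := hq
  obtain ⟨l, hl0, hl1, rfl⟩ := hw
  have hf : f = 0 := hh
  subst hf
  obtain ⟨a, b, L, hab, hL, rfl, rfl⟩ : ∃ a b L : ℝ, a ^ 2 + b ^ 2 = 1 ∧ 0 ≤ L ∧ c = L * a ∧
      d = L * b := by
    by_cases h : c ^ 2 + d ^ 2 = 0
    · exact ⟨1, 0, 0, by norm_num, le_rfl, by nlinarith [sq_nonneg c, sq_nonneg d],
        by nlinarith [sq_nonneg c, sq_nonneg d]⟩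
    · have hpos : 0 < c ^ 2 + d ^ 2 := lt_of_le_of_ne (by positivity) (Ne.symm h)
      have hs := Real.sq_sqrt hpos.le
      have hs0 := Real.sqrt_pos.2 hpos
      refine ⟨c / √(c ^ 2 + d ^ 2), d / √(c ^ 2 + d ^ 2), √(c ^ 2 + d ^ 2), ?_, hs0.le, ?_, ?_⟩
      · rw [div_pow, div_pow, hs, ← add_div, div_self h]
      · field_simp
      · field_simp
  refine ⟨a, b, (1 - l) * L, l * L, hab, mul_nonneg (by linarith) hL, mul_nonneg hl0 hL, ?_, ?_⟩ <;>
  · ext <;> simp [hMove, hMul] <;> ring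

theorem statement13 (hCP : CPholds) (C : ℝ)
    (K₀ : Set Heis) (hK₀ : IsCompact K₀)
    (u₀ : Heis → ℝ) (hu₀c : Continuous u₀)
    (hu₀qc : HQuasiconvexOn u₀ Set.univ)
    (hu₀out : ∀ p ∉ K₀, u₀ p = C)
    (uhat : ℕ → Heis → ℝ) (huhatc : ∀ j, Continuous (uhat j))
    (huhatqc : ∀ j, ∃ r₀ lam : ℝ, 0 < r₀ ∧ 0 < lam ∧
      UniformlyHQuasiconvexOn (uhat j) Set.univ r₀ lam)
    (huhatgrowth : ∀ j, ∃ L : ℝ, 0 < L ∧ ∀ p : Heis, uhat j p ≤ L * (gaugeK p ^ 4 + 1))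
    (huhatout : ∀ j, ∀ p ∉ K₀, min (uhat j p) C = C)
    (hconv : TendstoUniformly (fun j p => min (uhat j p) C) u₀ atTop)
    (u : Heis × ℝ → ℝ) (hucont : ContinuousOn u {q : Heis × ℝ | 0 ≤ q.2})
    (hsub : FlowSubsolution u) (hsup : FlowSupersolution u)
    (hinit : ∀ p : Heis, u (p, 0) = u₀ p)
    (huleC : ∀ q : Heis × ℝ, 0 ≤ q.2 → u q ≤ C)
    (huout : ∀ q : Heis × ℝ, 0 ≤ q.2 → q.1 ∉ K₀ → u q = C) :
    ∀ t : ℝ, 0 ≤ t → HQuasiconvexOn (fun p => u (p, t)) Set.univ := by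
  have hu₀C : ∀ q, u₀ q ≤ C := fun q => hinit q ▸ huleC (q, 0) le_rfl
  obtain ⟨m, hm⟩ := exists_lower_bound hu₀c hK₀ hu₀out
  have happrox : ∀ η > 0, ∀ᶠ k in atTop,
      (∀ z : Heis × ℝ, u₀ z.1 - η ≤ gameVal u₀ k z) ∧
      ∀ (p : Heis) (t a b : ℝ), a ^ 2 + b ^ 2 = 1 → ∀ i j : ℕ,
        gameVal u₀ k (p, t) ≤ max (gameVal u₀ k (hMove p (-(i * stepSize k)) a b, t))
          (gameVal u₀ k (hMove p (j * stepSize k) a b, t)) + η := by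
    intro η hη
    obtain ⟨j, hj⟩ := (Metric.tendstoUniformly_iff.1 hconv (η / 2) (half_pos hη)).exists
    have hj' : ∀ q, |u₀ q - min (uhat j q) C| ≤ η / 2 := fun q => (hj q).le
    obtain ⟨r₀, lam, hr₀, hlam, hf⟩ := huhatqc j
    obtain ⟨m', hm'⟩ := exists_lower_bound ((huhatc j).min continuous_const) hK₀ (huhatout j)
    have hmf : ∀ q, min m m' ≤ min (uhat j q) C := fun q => (min_le_right _ _).trans (hm' q)
    have hmf' : ∀ q, min m m' ≤ uhat j q := fun q => (hmf q).trans (min_le_left _ _)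
    have hmu : ∀ q, min m m' ≤ u₀ q := fun q => (min_le_left _ _).trans (hm q)
    have h1 : ∀ q, u₀ q ≤ min (uhat j q) C + η / 2 := fun q => by linarith [(abs_le.1 (hj' q)).2]
    have h2 : ∀ q, min (uhat j q) C ≤ u₀ q + η / 2 := fun q => by linarith [(abs_le.1 (hj' q)).1]
    filter_upwards [tendsto_stepSize.eventually (gt_mem_nhds hr₀)] with k hk
    refine ⟨fun z => ?_, fun p t a b hab i l => ?_⟩
    · have := sub_le_gameStep_iterate_of_uniformly hlam hf (stepSize_pos k) hk hmf' hmf h1 h2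
        ⌊z.2 / (stepSize k ^ 2 / 2)⌋₊ z.1
      unfold gameVal
      linarith
    · have := gameStep_iterate_quasiconvex_of_uniformly hlam hf (stepSize_pos k) hk hmf' hmf hmu
        h1 h2 ⌊t / (stepSize k ^ 2 / 2)⌋₊ p hab i l
      unfold gameVal
      linarith
  have hV := abs_gameVal_le hm hu₀C
  have hV' : ∀ k z, |-gameVal u₀ k z| ≤ max |m| |C| := fun k z => (abs_neg _).trans_le (hV k z)
  have hge := le_upLim_gameVal_and_le_lowLim hu₀c hm hu₀C
    fun η hη => (happrox η hη).mono fun _ h => h.1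
  have hupC : ∀ z, upLim (gameVal u₀) z ≤ C := fun z => upLim_le_of_eventually hV
    (Eventually.of_forall fun x => gameStep_iterate_le hm hu₀C _ _)
  have hlowC : ∀ z, lowLim (gameVal u₀) z ≤ C := fun z => neg_le.1
    (le_upLim_of_eventually hV'
      (Eventually.of_forall fun x => neg_le_neg (gameStep_iterate_le hm hu₀C _ _)))
  have hup : ∀ z : Heis × ℝ, 0 ≤ z.2 → upLim (gameVal u₀) z ≤ u z :=
    hCP C K₀ hK₀ _ _ ((upperSemicontinuous_upLim hV).upperSemicontinuousOn _)
      hucont.lowerSemicontinuousOn (flowSubsolution_upLim_gameVal hm hu₀C) hsup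
      (fun q hq => ⟨hupC q, huleC q hq⟩)
      (fun q hq hqK => ⟨le_antisymm (hupC q) (hu₀out _ hqK ▸ (hge q).1), huout q hq hqK⟩)
      (fun p => (upLim_gameVal_zero_le hu₀c hm hu₀C p).trans (hinit p).ge)
  have hlow : ∀ z : Heis × ℝ, 0 ≤ z.2 → u z ≤ lowLim (gameVal u₀) z :=
    hCP C K₀ hK₀ _ _ hucont.upperSemicontinuousOn
      ((lowerSemicontinuous_lowLim hV).lowerSemicontinuousOn _) hsub
      (flowSupersolution_lowLim_gameVal hm hu₀C)
      (fun q hq => ⟨huleC q hq, hlowC q⟩)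
      (fun q hq hqK => ⟨huout q hq hqK, le_antisymm (hlowC q) (hu₀out _ hqK ▸ (hge q).2)⟩)
      (fun p => (hinit p).le.trans (hge (p, 0)).2)
  intro t ht p _ q _ hq w hw
  obtain ⟨a, b, s, s', hab, hs, hs', hp, hq'⟩ := exists_hMove_of_mem_hSeg hq hw
  have hlim : ∀ σ : ℕ → ℝ, ∀ σ₀ : ℝ, Tendsto σ atTop (𝓝 σ₀) → ∀ η > 0, ∀ᶠ k in atTop,
      gameVal u₀ k (hMove w (σ k) a b, t) < u (hMove w σ₀ a b, t) + η := by
    intro σ σ₀ hσ η hη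
    have hcont : Continuous fun r : ℝ => (hMove w r a b, t) := by unfold hMove; fun_prop
    exact (tendsto_id.prodMk ((hcont.tendsto σ₀).comp hσ)).eventually
      (eventually_lt_of_upLim_lt hV
        (show upLim (gameVal u₀) (hMove w σ₀ a b, t) < u (hMove w σ₀ a b, t) + η by
          linarith [hup (hMove w σ₀ a b, t) ht]))
  refine le_of_forall_pos_le_add fun η hη => ?_
  have hη3 : 0 < η / 3 := by linarith
  have hw' : ∀ᶠ k in atTop, -gameVal u₀ k (w, t) < -u (w, t) + η / 3 :=
    (tendsto_id.prodMk tendsto_const_nhds).eventually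
      (eventually_lt_of_upLim_lt hV'
        (show upLim (fun k z => -gameVal u₀ k z) (w, t) < -u (w, t) + η / 3 by
          have := hlow (w, t) ht
          unfold lowLim at this
          linarith))
  obtain ⟨k, h1, h2, h3, h4⟩ := (hw'.and ((hlim _ _ (tendsto_floor_div_stepSize_mul hs).neg _
    hη3).and ((hlim _ _ (tendsto_floor_div_stepSize_mul hs') _ hη3).and
      (happrox _ hη3)))).exists
  rw [← hp] at h2
  rw [← hq'] at h3
  have h5 := h4.2 w t a b hab ⌊s / stepSize k⌋₊ ⌊s' / stepSize k⌋₊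
  have h6 := max_le_max h2.le h3.le
  rw [max_add_add_right] at h6
  simp only
  linarith
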